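/- Let q > 1 be a real number, let α₁ = ⌈q⌉ − 1, and let (α_i) = (α_i(q)) be the quasi-greedy expansion of 1 in base q. A sequence (c_i)_{i≥1} with terms in {0, …, α₁} is univoque in base q (i.e., the number x = ∑_{i=1}^∞ c_i q^{−i} has exactly one expansion in base q) if and only if both of the following hold: for every n ≥ 1 with c_n < α₁, the shifted sequence (c_{n+i})_{i≥1} is lexicographically smaller than (α_i)_{i≥1}; and for every n ≥ 1 with c_n > 0, the conjugated shifted sequence (α₁ − c_{n+i})_{i≥1} is lexicographically smaller than (α_i)_{i≥1}. -/

import Mathlib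

open Classical

noncomputable section

/-- The largest digit in base `q`: `α₁ = ⌈q⌉ - 1`. -/
def alphaOne (q : ℝ) : ℕ := (⌈q⌉ - 1).toNat

/-- `c` (0-indexed: `c i` is the digit `c_{i+1}` of the paper) is an expansion of `x`
in base `q`: all digits lie in `{0, …, α₁}` and `x = ∑_{i≥1} c_i q^{-i}`. -/
def IsExpansionOf (q x : ℝ) (c : ℕ → ℕ) : Prop :=
  (∀ i, c i ≤ alphaOne q) ∧ x = ∑' i, (c i : ℝ) / q ^ (i + 1)

/-- A sequence is called infinite if it has infinitely many nonzero terms. -/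
def InfiniteSeq (c : ℕ → ℕ) : Prop := {i | c i ≠ 0}.Infinite

/-- Strict lexicographic order on sequences. -/
def LexLt (a b : ℕ → ℕ) : Prop := ∃ n, (∀ i, i < n → a i = b i) ∧ a n < b n

/-- Lexicographic order `≤` on sequences. -/
def LexLe (a b : ℕ → ℕ) : Prop := LexLt a b ∨ a = b

/-- `b` is the greedy (lexicographically largest) expansion of `x` in base `q`. -/
def IsGreedyOf (q x : ℝ) (b : ℕ → ℕ) : Prop :=
  IsExpansionOf q x b ∧ ∀ c, IsExpansionOf q x c → LexLe c b

/-- `a` is the quasi-greedy (lexicographically largest infinite) expansion of `x`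
in base `q`. -/
def IsQuasiGreedyOf (q x : ℝ) (a : ℕ → ℕ) : Prop :=
  IsExpansionOf q x a ∧ InfiniteSeq a ∧
    ∀ c, IsExpansionOf q x c → InfiniteSeq c → LexLe c a

/-- The quasi-greedy expansion of `x` in base `q`; by convention it is the zero
sequence whenever no infinite expansion exists (in particular for `x = 0`). -/
def quasiGreedy (q x : ℝ) : ℕ → ℕ :=
  if h : ∃ a, IsQuasiGreedyOf q x a then h.choose else fun _ => 0

/-- The greedy expansion of `x` in base `q` (zero sequence if `x` has no expansion). -/
def greedy (q x : ℝ) : ℕ → ℕ :=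
  if h : ∃ b, IsGreedyOf q x b then h.choose else fun _ => 0

/-- The interval `J_q = [0, α₁/(q-1)]`. -/
def Jq (q : ℝ) : Set ℝ := Set.Icc 0 ((alphaOne q : ℝ) / (q - 1))

/-- `U_q`: the set of real numbers having exactly one expansion in base `q`. -/
def Uq (q : ℝ) : Set ℝ := {x | ∃! c, IsExpansionOf q x c}

/-- `U_q'`: the set of univoque sequences in base `q`. -/
def UqSeq (q : ℝ) : Set (ℕ → ℕ) := {c | ∃ x ∈ Uq q, IsExpansionOf q x c}

/-- `U`: the set of univoque numbers. -/
def USet : Set ℝ := {q | 1 < q ∧ ∃! c, IsExpansionOf q 1 c}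

/-- `V_q`: the set of `x ∈ J_q` such that for every `n ≥ 1` with `a_n(x) > 0` the
conjugated shifted quasi-greedy expansion is lexicographically at most `(α_i)`. -/
def Vq (q : ℝ) : Set ℝ :=
  {x | x ∈ Jq q ∧ ∀ n, 0 < quasiGreedy q x n →
    LexLe (fun i => alphaOne q - quasiGreedy q x (n + 1 + i)) (quasiGreedy q 1)}

/-- `V`: the set of `q > 1` whose quasi-greedy expansion `(α_i)` of `1` satisfies
`(α₁ - α_{k+i})_{i≥1} ≤ (α_i)_{i≥1}` lexicographically for all `k ≥ 1`. -/
def VSet : Set ℝ :=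
  {q | 1 < q ∧ ∀ k, LexLe (fun i => alphaOne q - quasiGreedy q 1 (k + 1 + i)) (quasiGreedy q 1)}

/-- The number represented in base `q` by the digit sequence `c` from position `n` on. -/
def tailValue (q : ℝ) (c : ℕ → ℕ) (n : ℕ) : ℝ := ∑' i, (c (n + i) : ℝ) / q ^ (i + 1)

/-- The sequence obtained by replacing each digit `c i` by `K - c i`. -/
def conjSeq (K : ℕ) (c : ℕ → ℕ) : ℕ → ℕ := fun i => K - c i

theorem alphaOne_cast {q : ℝ} (hq : 1 < q) : ((alphaOne q : ℕ) : ℤ) = ⌈q⌉ - 1 := by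
  have h : (1 : ℤ) < ⌈q⌉ := Int.lt_ceil.2 (by exact_mod_cast hq)
  exact Int.toNat_of_nonneg (by omega)

theorem le_alphaOne_add_one {q : ℝ} (hq : 1 < q) : q ≤ alphaOne q + 1 := by
  have h : ((alphaOne q : ℕ) : ℝ) = ⌈q⌉ - 1 := by exact_mod_cast alphaOne_cast hq
  rw [h]
  linarith [Int.le_ceil q]

theorem hasSum_of_remainder {q B : ℝ} (hq : 1 < q) {r : ℕ → ℝ} {a : ℕ → ℕ}
    (hB : ∀ n, |r n| ≤ B) (hr : ∀ n, r (n + 1) = q * r n - a n) :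
    HasSum (fun i => (a i : ℝ) / q ^ (i + 1)) (r 0) := by
  have hq0 : 0 < q := by linarith
  rw [hasSum_iff_tendsto_nat_of_nonneg (fun i => by positivity)]
  have hsum : ∀ n, ∑ i ∈ Finset.range n, (a i : ℝ) / q ^ (i + 1) = r 0 - r n / q ^ n := by
    intro n
    induction n with
    | zero => simp
    | succ n ih =>
      rw [Finset.sum_range_succ, ih, hr]
      field_simp
      ring
  have hlim : Filter.Tendsto (fun n => r n / q ^ n) Filter.atTop (nhds 0) := by
    have hg : Filter.Tendsto (fun n : ℕ => B * (q⁻¹) ^ n) Filter.atTop (nhds 0) := by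
      simpa using (tendsto_pow_atTop_nhds_zero_of_lt_one (inv_nonneg.2 hq0.le)
        (inv_lt_one_of_one_lt₀ hq)).const_mul B
    refine squeeze_zero_norm (fun n => ?_) hg
    rw [Real.norm_eq_abs, abs_div, abs_of_pos (pow_pos hq0 n), inv_pow, ← div_eq_mul_inv]
    gcongr
    exact hB n
  simp only [hsum]
  simpa using hlim.const_sub (r 0)

theorem hasSum_const_digits {q : ℝ} (hq : 1 < q) (K : ℕ) :
    HasSum (fun i => (K : ℝ) / q ^ (i + 1)) (K / (q - 1)) :=
  hasSum_of_remainder hq (r := fun _ => (K : ℝ) / (q - 1)) (a := fun _ => K)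
    (fun _ => le_rfl) (fun _ => by
      have : q - 1 ≠ 0 := by linarith
      field_simp
      ring)

theorem summable_digits {q : ℝ} (hq : 1 < q) {K : ℕ} {c : ℕ → ℕ} (hc : ∀ i, c i ≤ K) :
    Summable (fun i => (c i : ℝ) / q ^ (i + 1)) := by
  have hq0 : 0 < q := by linarith
  refine Summable.of_nonneg_of_le (fun i => by positivity) (fun i => ?_)
    (hasSum_const_digits hq K).summable
  gcongr
  exact hc i

theorem tailValue_zero (q : ℝ) (c : ℕ → ℕ) :
    tailValue q c 0 = ∑' i, (c i : ℝ) / q ^ (i + 1) := by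
  simp [tailValue]

theorem tailValue_nonneg {q : ℝ} (hq : 1 < q) (c : ℕ → ℕ) (n : ℕ) : 0 ≤ tailValue q c n := by
  have hq0 : 0 < q := by linarith
  exact tsum_nonneg fun i => by positivity

theorem tailValue_le {q : ℝ} (hq : 1 < q) {K : ℕ} {c : ℕ → ℕ} (hc : ∀ i, c i ≤ K) (n : ℕ) :
    tailValue q c n ≤ K / (q - 1) := by
  have hq0 : 0 < q := by linarith
  have h := hasSum_const_digits hq K
  rw [← h.tsum_eq]
  refine (summable_digits hq (c := fun i => c (n + i)) (fun i => hc _)).tsum_le_tsum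
    (fun i => ?_) h.summable
  gcongr
  exact hc _

theorem tailValue_succ {q : ℝ} (hq : 1 < q) {K : ℕ} {c : ℕ → ℕ} (hc : ∀ i, c i ≤ K) (n : ℕ) :
    tailValue q c (n + 1) = q * tailValue q c n - c n := by
  have hq0 : q ≠ 0 := by linarith
  have h := (summable_digits hq (c := fun i => c (n + i)) (fun i => hc _)).tsum_eq_zero_add
  have h' : ∑' i, (c (n + (i + 1)) : ℝ) / q ^ (i + 1 + 1) = tailValue q c (n + 1) / q := by
    rw [tailValue, ← tsum_div_const]
    refine tsum_congr fun i => ?_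
    rw [show n + (i + 1) = n + 1 + i by ring, pow_succ q (i + 1), div_div]
  rw [h'] at h
  change tailValue q c n = _ at h
  rw [h]
  field_simp
  simp

theorem tailValue_add {q : ℝ} (c : ℕ → ℕ) (m n : ℕ) :
    tailValue q (fun i => c (m + i)) n = tailValue q c (m + n) := by
  simp only [tailValue, add_assoc]

theorem tailValue_sub_of_agree {q : ℝ} (hq : 1 < q) {K : ℕ} {c d : ℕ → ℕ}
    (hc : ∀ i, c i ≤ K) (hd : ∀ i, d i ≤ K) {n : ℕ} (h : ∀ i, i < n → c i = d i) :
    tailValue q c n - tailValue q d n = q ^ n * (tailValue q c 0 - tailValue q d 0) := by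
  induction n with
  | zero => simp
  | succ n ih =>
    rw [tailValue_succ hq hc, tailValue_succ hq hd, h n (by omega), pow_succ]
    linear_combination q * ih (fun i hi => h i (by omega))

theorem tailValue_conjSeq {q : ℝ} (hq : 1 < q) {K : ℕ} {c : ℕ → ℕ} (hc : ∀ i, c i ≤ K) :
    tailValue q (conjSeq K c) 0 = K / (q - 1) - tailValue q c 0 := by
  rw [tailValue_zero, tailValue_zero]
  have h := (hasSum_const_digits hq K).sub (summable_digits hq hc).hasSum
  rw [← h.tsum_eq]
  refine tsum_congr fun i => ?_
  rw [conjSeq, Nat.cast_sub (hc i), sub_div]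

theorem conjSeq_le (K : ℕ) (c : ℕ → ℕ) (i : ℕ) : conjSeq K c i ≤ K := Nat.sub_le _ _

theorem conjSeq_conjSeq {K : ℕ} {c : ℕ → ℕ} (hc : ∀ i, c i ≤ K) :
    conjSeq K (conjSeq K c) = c :=
  funext fun i => Nat.sub_sub_self (hc i)

theorem lexLt_trichotomy (a b : ℕ → ℕ) : LexLt a b ∨ a = b ∨ LexLt b a := by
  by_cases h : a = b
  · exact Or.inr (Or.inl h)
  have hex : ∃ n, a n ≠ b n := Function.ne_iff.1 h
  have hmin : ∀ i, i < Nat.find hex → a i = b i := fun i hi => not_not.1 (Nat.find_min hex hi)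
  rcases lt_or_gt_of_ne (Nat.find_spec hex) with hlt | hlt
  · exact Or.inl ⟨_, hmin, hlt⟩
  · exact Or.inr (Or.inr ⟨_, fun i hi => (hmin i hi).symm, hlt⟩)

theorem not_lexLt_of_lexLt {a b : ℕ → ℕ} (h : LexLt a b) : ¬ LexLt b a := by
  rintro ⟨m, hm, hlt⟩
  obtain ⟨n, hn, hlt'⟩ := h
  rcases lt_trichotomy m n with hmn | rfl | hmn
  · have := hn m hmn
    omega
  · omega
  · have := hm n hmn
    omega

theorem lexLe_antisymm {a b : ℕ → ℕ} (h : LexLe a b) (h' : LexLe b a) : a = b := by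
  rcases h with h | h
  · rcases h' with h' | h'
    · exact absurd h' (not_lexLt_of_lexLt h)
    · exact h'.symm
  · exact h

theorem exists_expansion {q y : ℝ} (hq : 1 < q) {K : ℕ} (hK : q ≤ K + 1) (hy : 0 ≤ y)
    (hy' : y ≤ K / (q - 1)) : ∃ e : ℕ → ℕ, (∀ i, e i ≤ K) ∧ tailValue q e 0 = y := by
  have hq1 : 0 < q - 1 := by linarith
  let r : ℕ → ℝ := fun n => Nat.rec y (fun _ z => q * z - (min K ⌊q * z⌋₊ : ℕ)) n
  have hr : ∀ n, r (n + 1) = q * r n - (min K ⌊q * r n⌋₊ : ℕ) := fun n => rfl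
  have hmem : ∀ n, 0 ≤ r n ∧ r n ≤ K / (q - 1) := by
    intro n
    induction n with
    | zero => exact ⟨hy, hy'⟩
    | succ n ih =>
      have h0 : 0 ≤ q * r n := mul_nonneg (by linarith) ih.1
      rw [hr]
      rcases le_total K ⌊q * r n⌋₊ with h | h
      · rw [min_eq_left h]
        have h1 : (K : ℝ) ≤ q * r n := (Nat.le_floor_iff h0).1 h
        have h2 : q * r n ≤ q * (K / (q - 1)) := by
          have := ih.2
          gcongr
        have h3 : q * (K / (q - 1)) - K = K / (q - 1) := by
          field_simp
          ring
        exact ⟨by linarith, by linarith⟩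
      · rw [min_eq_right h]
        have h1 := Nat.floor_le h0
        have h2 := Nat.lt_floor_add_one (q * r n)
        have h3 : 1 ≤ (K : ℝ) / (q - 1) := (one_le_div hq1).2 (by linarith)
        exact ⟨by linarith, by linarith⟩
  refine ⟨fun n => min K ⌊q * r n⌋₊, fun n => min_le_left _ _, ?_⟩
  rw [tailValue_zero]
  exact (hasSum_of_remainder hq (r := r) (B := K / (q - 1))
    (fun n => abs_le.2 ⟨by linarith [(hmem n).1, (hmem n).2], (hmem n).2⟩) hr).tsum_eq

/-- The quasi-greedy algorithm produces an expansion of `1` all of whose tails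
represent numbers in `(0, 1]`. -/
theorem exists_expansion_one {q : ℝ} (hq : 1 < q) :
    ∃ a : ℕ → ℕ, (∀ i, a i ≤ alphaOne q) ∧ tailValue q a 0 = 1 ∧
      ∀ n, 0 < tailValue q a n ∧ tailValue q a n ≤ 1 := by
  have hq0 : 0 < q := by linarith
  let r : ℕ → ℝ := fun n => Nat.rec 1 (fun _ z => q * z - ((⌈q * z⌉ - 1).toNat : ℕ)) n
  let a : ℕ → ℕ := fun n => (⌈q * r n⌉ - 1).toNat
  have hr : ∀ n, r (n + 1) = q * r n - a n := fun n => rfl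
  have hcast : ∀ n, 0 < r n → ((a n : ℕ) : ℝ) = ⌈q * r n⌉ - 1 := by
    intro n hn
    have h : 0 < ⌈q * r n⌉ := Int.ceil_pos.2 (mul_pos hq0 hn)
    have h' : ((a n : ℕ) : ℤ) = ⌈q * r n⌉ - 1 := Int.toNat_of_nonneg (by omega)
    exact_mod_cast h'
  have hmem : ∀ n, 0 < r n ∧ r n ≤ 1 := by
    intro n
    induction n with
    | zero => exact ⟨one_pos, le_rfl⟩
    | succ n ih =>
      rw [hr, hcast n ih.1]
      have h1 := Int.le_ceil (q * r n)
      have h2 := Int.ceil_lt_add_one (q * r n)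
      exact ⟨by linarith, by linarith⟩
  have ha : ∀ n, a n ≤ alphaOne q := by
    intro n
    have h : ⌈q * r n⌉ ≤ ⌈q⌉ := Int.ceil_mono (mul_le_of_le_one_right hq0.le (hmem n).2)
    exact Int.toNat_le_toNat (by omega)
  have h0 : tailValue q a 0 = 1 := by
    rw [tailValue_zero]
    exact (hasSum_of_remainder hq (r := r) (B := 1)
      (fun n => abs_le.2 ⟨by linarith [(hmem n).1], (hmem n).2⟩) hr).tsum_eq
  have heq : ∀ n, tailValue q a n = r n := by
    intro n
    induction n with
    | zero => exact h0
    | succ n ih => rw [tailValue_succ hq ha, ih, hr]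
  exact ⟨a, ha, h0, fun n => by rw [heq]; exact hmem n⟩

theorem tailValue_eq_zero {q : ℝ} {c : ℕ → ℕ} {n : ℕ} (h : ∀ i, n ≤ i → c i = 0) :
    tailValue q c n = 0 := by
  simp [tailValue, h]

theorem tailValue_pos {q : ℝ} (hq : 1 < q) {K : ℕ} {c : ℕ → ℕ} (hc : ∀ i, c i ≤ K)
    (hinf : InfiniteSeq c) (n : ℕ) : 0 < tailValue q c n := by
  have hq0 : 0 < q := by linarith
  obtain ⟨m, hm, hnm⟩ := Set.Infinite.exists_gt hinf n
  have hs := summable_digits hq (c := fun i => c (n + i)) (fun i => hc _)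
  refine hs.tsum_pos (fun i => by positivity) (m - n) ?_
  have : 0 < c (n + (m - n)) := by
    rw [Nat.add_sub_cancel' hnm.le]
    exact Nat.pos_of_ne_zero hm
  positivity

/-- A sequence lexicographically exceeding an expansion of `1` with tails in `[0, 1]`
represents a number at least `1`, and more than `1` if it is infinite. -/
theorem one_le_tailValue_of_lexLt {q : ℝ} (hq : 1 < q) {K : ℕ} {a d : ℕ → ℕ}
    (ha : ∀ i, a i ≤ K) (hd : ∀ i, d i ≤ K) (ha0 : tailValue q a 0 = 1)
    (htail : ∀ n, tailValue q a n ≤ 1) (h : LexLt a d) :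
    1 ≤ tailValue q d 0 ∧ (InfiniteSeq d → 1 < tailValue q d 0) := by
  obtain ⟨n, hn, hlt⟩ := h
  have hagree := tailValue_sub_of_agree hq hd ha (fun i hi => (hn i hi).symm)
  have h1 := tailValue_succ hq hd n
  have h2 := tailValue_succ hq ha n
  have h3 := htail (n + 1)
  have hlt' : (a n : ℝ) + 1 ≤ d n := by exact_mod_cast hlt
  have hpow : 0 < q ^ (n + 1) := pow_pos (by linarith) _
  have key : q ^ (n + 1) * (tailValue q d 0 - 1) =
      (d n - a n - tailValue q a (n + 1)) + tailValue q d (n + 1) := by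
    rw [ha0] at hagree
    rw [pow_succ]
    linear_combination (-q) * hagree - h1 + h2
  constructor
  · have := tailValue_nonneg hq d (n + 1)
    have h4 : 0 ≤ q ^ (n + 1) * (tailValue q d 0 - 1) := by
      rw [key]
      linarith
    linarith [nonneg_of_mul_nonneg_right h4 hpow]
  · intro hinf
    have := tailValue_pos hq hd hinf (n + 1)
    have h4 : 0 < q ^ (n + 1) * (tailValue q d 0 - 1) := by
      rw [key]
      linarith
    linarith [(mul_pos_iff_of_pos_left hpow).1 h4]

theorem quasiGreedy_one_spec {q : ℝ} (hq : 1 < q) :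
    (∀ i, quasiGreedy q 1 i ≤ alphaOne q) ∧ tailValue q (quasiGreedy q 1) 0 = 1 ∧
      ∀ n, 0 < tailValue q (quasiGreedy q 1) n ∧ tailValue q (quasiGreedy q 1) n ≤ 1 := by
  obtain ⟨a, ha, ha0, hmem⟩ := exists_expansion_one hq
  have hqg : IsQuasiGreedyOf q 1 a := by
    refine ⟨⟨ha, by rw [← tailValue_zero, ha0]⟩, ?_, ?_⟩
    · intro hfin
      obtain ⟨M, hM⟩ := hfin.bddAbove
      refine (hmem (M + 1)).1.ne' (tailValue_eq_zero fun i hi => ?_)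
      by_contra hne
      have := hM hne
      omega
    · intro c hc hinf
      rcases lexLt_trichotomy c a with h | h | h
      · exact Or.inl h
      · exact Or.inr h
      · have h1 := (one_le_tailValue_of_lexLt hq ha hc.1 ha0 (fun n => (hmem n).2) h).2 hinf
        rw [tailValue_zero, ← hc.2] at h1
        exact absurd h1 (lt_irrefl _)
  have hex : ∃ a, IsQuasiGreedyOf q 1 a := ⟨a, hqg⟩
  have heq : quasiGreedy q 1 = a := by
    rw [quasiGreedy, dif_pos hex]
    have hs := hex.choose_spec
    exact lexLe_antisymm (hqg.2.2 _ hs.1 hs.2.1) (hs.2.2 _ hqg.1 hqg.2.1)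
  rw [heq]
  exact ⟨ha, ha0, hmem⟩

theorem mem_Uq_conjSeq {q : ℝ} (hq : 1 < q) {c : ℕ → ℕ} (hc : ∀ i, c i ≤ alphaOne q)
    (h : tailValue q c 0 ∈ Uq q) : tailValue q (conjSeq (alphaOne q) c) 0 ∈ Uq q := by
  refine ⟨_, ⟨conjSeq_le _ c, tailValue_zero _ _⟩, fun d hd => ?_⟩
  have h1 := tailValue_conjSeq hq hd.1
  rw [tailValue_zero q d, ← hd.2, tailValue_conjSeq hq hc, sub_sub_cancel] at h1
  have h2 : conjSeq (alphaOne q) d = c :=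
    h.unique ⟨conjSeq_le _ d, by rw [← tailValue_zero, h1]⟩ ⟨hc, tailValue_zero _ _⟩
  rw [← h2, conjSeq_conjSeq hd.1]

theorem tailValue_lt_one_of_mem_Uq {q : ℝ} (hq : 1 < q) {c : ℕ → ℕ}
    (hc : ∀ i, c i ≤ alphaOne q) (h : tailValue q c 0 ∈ Uq q) {n : ℕ} (hn : c n < alphaOne q) :
    tailValue q c (n + 1) < 1 := by
  by_contra! hge
  obtain ⟨e, he, hev⟩ := exists_expansion hq (le_alphaOne_add_one hq)
    (y := tailValue q c (n + 1) - 1) (by linarith)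
    (by linarith [tailValue_le hq hc (n + 1)])
  let d : ℕ → ℕ := fun i => if i < n then c i else if i = n then c n + 1 else e (i - (n + 1))
  have hd : ∀ i, d i ≤ alphaOne q := by
    intro i
    simp only [d]
    split_ifs
    exacts [hc i, hn, he _]
  have hdn : d n = c n + 1 := by simp [d]
  have htail : tailValue q d (n + 1) = tailValue q e 0 := by
    rw [← add_zero (n + 1), ← tailValue_add]
    congr 1
    funext i
    simp only [d]
    rw [if_neg (by omega), if_neg (by omega), Nat.add_sub_cancel_left]
  have hagree := tailValue_sub_of_agree hq hd hc (n := n) (fun i hi => by simp [d, hi])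
  have h1 := tailValue_succ hq hd n
  have h2 := tailValue_succ hq hc n
  rw [htail, hev, hdn] at h1
  push_cast at h1
  have hq0 : 0 < q := by linarith
  have h3 : q * (q ^ n * (tailValue q d 0 - tailValue q c 0)) = 0 := by
    rw [← hagree]
    linarith
  have h4 : tailValue q d 0 = tailValue q c 0 := by
    have hp : q ^ n ≠ 0 := (pow_pos hq0 n).ne'
    simpa [hq0.ne', hp, sub_eq_zero] using h3
  have h5 : d = c :=
    h.unique ⟨hd, by rw [← tailValue_zero, h4]⟩ ⟨hc, tailValue_zero _ _⟩
  rw [h5] at hdn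
  omega

theorem lexLt_of_mem_Uq {q : ℝ} (hq : 1 < q) {c : ℕ → ℕ}
    (hc : ∀ i, c i ≤ alphaOne q) (h : tailValue q c 0 ∈ Uq q) {n : ℕ} (hn : c n < alphaOne q) :
    LexLt (fun i => c (n + 1 + i)) (quasiGreedy q 1) := by
  obtain ⟨ha, ha0, hmem⟩ := quasiGreedy_one_spec hq
  have hlt := tailValue_lt_one_of_mem_Uq hq hc h hn
  have hshift : tailValue q (fun i => c (n + 1 + i)) 0 = tailValue q c (n + 1) :=
    tailValue_add c (n + 1) 0
  rcases lexLt_trichotomy (fun i => c (n + 1 + i)) (quasiGreedy q 1) with h' | h' | h'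
  · exact h'
  · rw [h', ha0] at hshift
    linarith
  · have := (one_le_tailValue_of_lexLt hq ha (fun i => hc _) ha0 (fun n => (hmem n).2) h').1
    linarith

theorem tailValue_lt_one_of_lexLt {q : ℝ} (hq : 1 < q) {c : ℕ → ℕ}
    (hc : ∀ i, c i ≤ alphaOne q)
    (h : ∀ n, c n < alphaOne q → LexLt (fun i => c (n + 1 + i)) (quasiGreedy q 1))
    {n : ℕ} (hn : c n < alphaOne q) : tailValue q c (n + 1) < 1 := by
  obtain ⟨ha, ha0, hmem⟩ := quasiGreedy_one_spec hq
  have hq0 : 0 < q := by linarith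
  have step : ∀ n, c n < alphaOne q → ∃ m k, c m < alphaOne q ∧
      q ^ (k + 1) * (tailValue q c (n + 1) - 1) < tailValue q c (m + 1) - 1 := by
    intro n hn
    obtain ⟨k, hk, hlt⟩ := h n hn
    refine ⟨n + 1 + k, k, hlt.trans_le (ha k), ?_⟩
    have hd : ∀ i, (fun i => c (n + 1 + i)) i ≤ alphaOne q := fun i => hc _
    have hagree := tailValue_sub_of_agree hq hd ha hk
    rw [tailValue_add, tailValue_add, ha0, add_zero] at hagree
    have h1 := tailValue_succ hq hc (n + 1 + k)
    have h2 := tailValue_succ hq ha k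
    have h3 := (hmem (k + 1)).1
    have hlt' : (c (n + 1 + k) : ℝ) + 1 ≤ quasiGreedy q 1 k := by exact_mod_cast hlt
    have key : q ^ (k + 1) * (tailValue q c (n + 1) - 1) =
        c (n + 1 + k) + tailValue q c (n + 1 + k + 1) - quasiGreedy q 1 k -
          tailValue q (quasiGreedy q 1) (k + 1) := by
      rw [pow_succ]
      linear_combination (-q) * hagree - h1 + h2
    rw [key]
    linarith
  have bound : ∀ k n, c n < alphaOne q →
      q ^ k * (tailValue q c (n + 1) - 1) ≤ alphaOne q / (q - 1) := by
    intro k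
    induction k with
    | zero =>
      intro n _
      linarith [tailValue_le hq hc (n + 1)]
    | succ k ih =>
      intro n hn
      rcases le_or_gt (tailValue q c (n + 1) - 1) 0 with hneg | hpos
      · have h1 : 0 ≤ (alphaOne q : ℝ) / (q - 1) := div_nonneg (by positivity) (by linarith)
        exact (mul_nonpos_of_nonneg_of_nonpos (by positivity) hneg).trans h1
      · obtain ⟨m, l, hm, hlt⟩ := step n hn
        refine le_trans ?_ (ih m hm)
        rw [pow_succ, mul_assoc]
        gcongr
        refine le_trans ?_ hlt.le
        gcongr
        exact le_self_pow₀ hq.le (Nat.succ_ne_zero l)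
  have nonpos : ∀ n, c n < alphaOne q → tailValue q c (n + 1) - 1 ≤ 0 := by
    intro n hn
    by_contra! hpos
    obtain ⟨k, hk⟩ := pow_unbounded_of_one_lt
      ((alphaOne q : ℝ) / (q - 1) / (tailValue q c (n + 1) - 1)) hq
    rw [div_lt_iff₀ hpos] at hk
    linarith [bound k n hn]
  obtain ⟨m, k, hm, hlt⟩ := step n hn
  have h1 : q ^ (k + 1) * (tailValue q c (n + 1) - 1) < 0 := hlt.trans_le (nonpos m hm)
  have := neg_of_mul_neg_right h1 (by positivity)
  linarith

theorem not_lexLt_of_tailValue_eq {q : ℝ} (hq : 1 < q) {K : ℕ} {c d : ℕ → ℕ}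
    (hc : ∀ i, c i ≤ K) (hd : ∀ i, d i ≤ K)
    (h : ∀ n, c n < K → tailValue q c (n + 1) < 1) (heq : tailValue q c 0 = tailValue q d 0) :
    ¬ LexLt c d := by
  rintro ⟨n, hn, hlt⟩
  have hagree := tailValue_sub_of_agree hq hc hd hn
  rw [heq, sub_self, mul_zero, sub_eq_zero] at hagree
  have h1 := tailValue_succ hq hc n
  have h2 := tailValue_succ hq hd n
  have h3 := h n (hlt.trans_le (hd n))
  have h4 := tailValue_nonneg hq d (n + 1)
  have hlt' : (c n : ℝ) + 1 ≤ d n := by exact_mod_cast hlt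
  rw [hagree] at h1
  linarith

theorem lexLt_conjSeq {K : ℕ} {c d : ℕ → ℕ} (hc : ∀ i, c i ≤ K) (h : LexLt d c) :
    LexLt (conjSeq K c) (conjSeq K d) := by
  obtain ⟨n, hn, hlt⟩ := h
  refine ⟨n, fun i hi => by simp [conjSeq, hn i hi], ?_⟩
  have := hc n
  simp only [conjSeq]
  omega

/-- Parry's characterization of univoque sequences.
A sequence `(c_i)` with digits in `{0, …, α₁}` is univoque in base `q` iff the shift
after every digit `< α₁` and the conjugated shift after every digit `> 0` are
lexicographically smaller than `(α_i)`. -/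
theorem univoque_iff_lex (q : ℝ) (hq : 1 < q) (c : ℕ → ℕ) (hc : ∀ i, c i ≤ alphaOne q) :
    (∑' i, (c i : ℝ) / q ^ (i + 1)) ∈ Uq q ↔
      (∀ n, c n < alphaOne q →
        LexLt (fun i => c (n + 1 + i)) (quasiGreedy q 1)) ∧
      (∀ n, 0 < c n →
        LexLt (fun i => alphaOne q - c (n + 1 + i)) (quasiGreedy q 1)) := by
  rw [← tailValue_zero]
  have hconj := conjSeq_le (alphaOne q) c
  have hdigit : ∀ n, conjSeq (alphaOne q) c n < alphaOne q ↔ 0 < c n := by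
    intro n
    have := hc n
    simp only [conjSeq]
    omega
  constructor
  · intro h
    exact ⟨fun n hn => lexLt_of_mem_Uq hq hc h hn,
      fun n hn => lexLt_of_mem_Uq hq hconj (mem_Uq_conjSeq hq hc h) ((hdigit n).2 hn)⟩
  · rintro ⟨h, h'⟩
    refine ⟨c, ⟨hc, tailValue_zero _ _⟩, fun d ⟨hd, hval⟩ => ?_⟩
    rw [← tailValue_zero] at hval
    rcases lexLt_trichotomy c d with hlt | heq | hlt
    · exact absurd hlt (not_lexLt_of_tailValue_eq hq hc hd
        (fun n hn => tailValue_lt_one_of_lexLt hq hc h hn) hval)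
    · exact heq.symm
    · refine absurd (lexLt_conjSeq hc hlt) (not_lexLt_of_tailValue_eq hq hconj
        (conjSeq_le _ d) (fun n hn => tailValue_lt_one_of_lexLt hq hconj
          (fun n hn => h' n ((hdigit n).1 hn)) hn) ?_)
      rw [tailValue_conjSeq hq hc, tailValue_conjSeq hq hd, hval]
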